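/- For every J ∈ 𝒥, the map f_J : L/B → ℤ is a well-defined cut detector of type γ; every cut detector of type γ equals f_J for some J ∈ 𝒥; and for J, J' ∈ 𝒥 one has f_J = f_{J'} if and only if J' = J + np for some n ∈ ℤ. (Equivalently, via the bijection between cut detectors of type γ and cuts of Q of type γ, the assignment J ↦ C(J) := C_{f_J} is a surjection from 𝒥 onto the set of cuts of Q of type γ whose fibers are exactly the ℤp-translation classes.) -/

import Mathlib

open scoped Classical

noncomputable section

namespace Paper

/-- The ambient lattice `ℤ^(d+1)`. -/
abbrev V (d : ℕ) : Type := Fin (d + 1) → ℤ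

/-- The coordinate-sum homomorphism. -/
def sumHom (d : ℕ) : V d →+ ℤ :=
  AddMonoidHom.mk' (fun v => ∑ i, v i) (fun a b => by
    simp [Finset.sum_add_distrib])

/-- The lattice `L` of integer vectors with coordinate sum zero. -/
def L (d : ℕ) : AddSubgroup (V d) := (sumHom d).ker

/-- `α i = e_i - e_{i-1}` (indices cyclic mod `d+1`), as an element of `L`. -/
def alpha (d : ℕ) (i : Fin (d + 1)) : L d :=
  ⟨Pi.single i 1 - Pi.single (i - 1) 1, by
    have : sumHom d (Pi.single i 1 - Pi.single (i - 1) 1) = 0 := by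
      simp [sumHom, Finset.sum_sub_distrib, Pi.single_apply]
    exact this⟩

/-- Arrows of the infinite quiver `Q̂`: the pair (source, type); the arrow of type `i`
with source `x` goes from `x` to `x + α i`. -/
abbrev ArrowHat (d : ℕ) : Type := L d × Fin (d + 1)

/-- Arrows of the quiver `Q` on `L/B`: the pair (source, type). -/
abbrev Arrow (d : ℕ) (B : AddSubgroup (L d)) : Type := (L d ⧸ B) × Fin (d + 1)

/-- The preimage among arrows of `Q̂` of a set of arrows of `Q`. -/
def preim (d : ℕ) (B : AddSubgroup (L d)) (C : Set (Arrow d B)) : Set (ArrowHat d) :=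
  {a | ((QuotientAddGroup.mk a.1 : L d ⧸ B), a.2) ∈ C}

/-- A set of arrows of `Q̂` is a cut if it contains exactly one arrow of every elementary
cycle.  Elementary cycles are exactly the cyclic paths of length `d+1` with pairwise distinct
types; they are parametrized by a starting vertex `x` and a permutation `σ` of the types,
the `k`-th arrow being the type-`σ k` arrow with source `x + ∑_{j<k} α (σ j)`. -/
def IsCutHat (d : ℕ) (Ch : Set (ArrowHat d)) : Prop :=
  ∀ (x : L d) (σ : Equiv.Perm (Fin (d + 1))),
    ∃! k : Fin (d + 1), (x + ∑ j ∈ Finset.Iio k, alpha d (σ j), σ k) ∈ Ch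

/-- A set of arrows of `Q̂` is `B`-periodic if it is invariant under translation by `B`. -/
def IsBPeriodic (d : ℕ) (B : AddSubgroup (L d)) (Ch : Set (ArrowHat d)) : Prop :=
  ∀ (a : ArrowHat d) (b : L d), b ∈ B → ((a.1 + b, a.2) ∈ Ch ↔ a ∈ Ch)

/-- A set of arrows of `Q` is a cut if its preimage among the arrows of `Q̂` is a cut. -/
def IsCut (d : ℕ) (B : AddSubgroup (L d)) (C : Set (Arrow d B)) : Prop :=
  IsCutHat d (preim d B C)

/-- The type of a cut of `Q`: the `i`-th entry is the number of arrows of type `i` in it. -/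
def cutType (d : ℕ) (B : AddSubgroup (L d)) (C : Set (Arrow d B)) : Fin (d + 1) → ℤ :=
  fun i => (Nat.card {v : L d ⧸ B // (v, i) ∈ C} : ℤ)

/-- A cut detector of type `γ`. -/
def IsCutDetector (d : ℕ) (B : AddSubgroup (L d)) (f : L d ⧸ B → ℤ)
    (γ : Fin (d + 1) → ℤ) : Prop :=
  f 0 = 0 ∧ ∀ (x : L d) (i : Fin (d + 1)),
    f (QuotientAddGroup.mk (x + alpha d i)) = f (QuotientAddGroup.mk x) + γ i ∨
    f (QuotientAddGroup.mk (x + alpha d i)) = f (QuotientAddGroup.mk x) + γ i - (B.index : ℤ)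

/-- The value `f_C` of an arrow of `Q̂`: `γ i - m` if the arrow lies in the given set of
arrows, and `γ i` otherwise (for an arrow of type `i`). -/
def arrowVal (d : ℕ) (Ch : Set (ArrowHat d)) (γ : Fin (d + 1) → ℤ) (m : ℤ)
    (a : ArrowHat d) : ℤ :=
  if a ∈ Ch then γ a.2 - m else γ a.2

/-- The value `f_C` of a path in `Q̂`, the path being recorded as its list of types together
with its source: the sum of the values of its arrows. -/
def pathVal (d : ℕ) (Ch : Set (ArrowHat d)) (γ : Fin (d + 1) → ℤ) (m : ℤ) :
    List (Fin (d + 1)) → L d → ℤ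
  | [], _ => 0
  | i :: p, x => arrowVal d Ch γ m (x, i) + pathVal d Ch γ m p (x + alpha d i)

/-- `f` is the function `f̄_C` induced by `f_C` on `L/B`:  for every `x ∈ L` and every path
`p` in `Q̂` from `0` to `x`, `f(x + B)` is the value of `p`. -/
def Detects (d : ℕ) (B : AddSubgroup (L d)) (C : Set (Arrow d B)) (γ : Fin (d + 1) → ℤ)
    (f : L d ⧸ B → ℤ) : Prop :=
  ∀ (x : L d) (p : List (Fin (d + 1))), (p.map (alpha d)).sum = x →
    f (QuotientAddGroup.mk x) = pathVal d (preim d B C) γ (B.index : ℤ) p 0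

/-- The set of arrows `C_f` of `Q` associated to a function `f : L/B → ℤ` (of type `γ`):
the arrows `x + B → x + α i + B` with `f(x + α i + B) = f(x + B) + γ i - m`. -/
def cutOf (d : ℕ) (B : AddSubgroup (L d)) (f : L d ⧸ B → ℤ) (γ : Fin (d + 1) → ℤ) :
    Set (Arrow d B) :=
  {a | ∃ x : L d, QuotientAddGroup.mk x = a.1 ∧
      f (QuotientAddGroup.mk (x + alpha d a.2)) = f a.1 + γ a.2 - (B.index : ℤ)}


/-- A path in the quiver `Q_C = Q ∖ C`, recorded as its list of types plus its source:
all its arrows avoid `C`. -/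
def avoids (d : ℕ) (B : AddSubgroup (L d)) (C : Set (Arrow d B)) :
    List (Fin (d + 1)) → (L d ⧸ B) → Prop
  | [], _ => True
  | i :: p, v => (v, i) ∉ C ∧ avoids d B C p (v + QuotientAddGroup.mk (alpha d i))

/-- A cut `C` of `Q` is bounding if the quiver `Q_C` obtained by deleting the arrows of `C`
has no cyclic path of positive length. -/
def IsBounding (d : ℕ) (B : AddSubgroup (L d)) (C : Set (Arrow d B)) : Prop :=
  ¬ ∃ (v : L d ⧸ B) (p : List (Fin (d + 1))), p ≠ [] ∧ avoids d B C p v ∧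
      v + QuotientAddGroup.mk ((p.map (alpha d)).sum) = v

/-- The homomorphism `Φ : ℤ^(d+1) → ℤ ⊕ L/B` with `Φ(e_i) = (γ_i, α_i + B)`. -/
def Phi (d : ℕ) (B : AddSubgroup (L d)) (γ : Fin (d + 1) → ℤ) :
    V d →+ ℤ × (L d ⧸ B) :=
  AddMonoidHom.mk'
    (fun v => (∑ i, v i * γ i, QuotientAddGroup.mk (∑ i, v i • alpha d i)))
    (fun a b => by
      have h1 : ∑ i, (a + b) i * γ i = (∑ i, a i * γ i) + ∑ i, b i * γ i := by
        rw [← Finset.sum_add_distrib]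
        exact Finset.sum_congr rfl fun i _ => by simp [add_mul]
      have h2 : (∑ i, (a + b) i • alpha d i) =
          (∑ i, a i • alpha d i) + ∑ i, b i • alpha d i := by
        rw [← Finset.sum_add_distrib]
        exact Finset.sum_congr rfl fun i _ => by simp [add_smul]
      show (∑ i, (a + b) i * γ i, QuotientAddGroup.mk (∑ i, (a + b) i • alpha d i)) =
        ((∑ i, a i * γ i, QuotientAddGroup.mk (∑ i, a i • alpha d i)) : ℤ × (L d ⧸ B)) +
          (∑ i, b i * γ i, QuotientAddGroup.mk (∑ i, b i • alpha d i))
      rw [Prod.mk_add_mk, h1, h2, QuotientAddGroup.mk_add])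

/-- The group `G(B,γ)`, the image of `Φ`. -/
abbrev GB (d : ℕ) (B : AddSubgroup (L d)) (γ : Fin (d + 1) → ℤ) :
    AddSubgroup (ℤ × (L d ⧸ B)) :=
  (Phi d B γ).range

/-- The element `x_i = Φ(e_i)` of `G(B,γ)`. -/
def xE (d : ℕ) (B : AddSubgroup (L d)) (γ : Fin (d + 1) → ℤ) (i : Fin (d + 1)) :
    GB d B γ :=
  ⟨Phi d B γ (Pi.single i 1), ⟨Pi.single i 1, rfl⟩⟩

/-- The element `p = ∑ x_i` of `G(B,γ)`. -/
def pE (d : ℕ) (B : AddSubgroup (L d)) (γ : Fin (d + 1) → ℤ) : GB d B γ :=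
  ∑ i, xE d B γ i

/-- Membership in `𝒥`: `J` contains exactly one element of every coset of `ℤp`, and for
`g ∈ J` and every `i`, `g + x_i ∈ J ∪ (J + p)`. -/
def InJ (d : ℕ) (B : AddSubgroup (L d)) (γ : Fin (d + 1) → ℤ)
    (J : Set (GB d B γ)) : Prop :=
  (∀ g : GB d B γ, ∃! n : ℤ, g + n • pE d B γ ∈ J) ∧
    ∀ g ∈ J, ∀ i : Fin (d + 1), g + xE d B γ i ∈ J ∨ g + xE d B γ i - pE d B γ ∈ J

/-- `f` is the function `f_J : L/B → ℤ` attached to `J ∈ 𝒥`:  whenever `n_J • p ∈ J`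
and `g ∈ J`, the value of `f` at the image of `g` under the second projection is
`π₁(g) - n_J · m`. -/
def IsFJ (d : ℕ) (B : AddSubgroup (L d)) (γ : Fin (d + 1) → ℤ)
    (J : Set (GB d B γ)) (f : L d ⧸ B → ℤ) : Prop :=
  ∀ n : ℤ, n • pE d B γ ∈ J → ∀ g ∈ J,
    f (g : ℤ × (L d ⧸ B)).2 = (g : ℤ × (L d ⧸ B)).1 - n * (B.index : ℤ)

/-- The cone of nonnegative integer combinations of the `x i`. -/
def cone {G : Type*} [AddCommGroup G] {n : ℕ} (x : Fin n → G) : Set G :=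
  {g | ∃ c : Fin n → ℕ, g = ∑ i, (c i : ℤ) • x i}

/-- Upper sets for the partial order `g ≤ h ↔ h - g ∈ cone x`. -/
def IsUpper {G : Type*} [AddCommGroup G] {n : ℕ} (x : Fin n → G) (I : Set G) : Prop :=
  ∀ g ∈ I, ∀ h : G, h - g ∈ cone x → h ∈ I

/-- `J(I) = I ∩ (Iᶜ + p)`. -/
def JofI {G : Type*} [AddCommGroup G] (p : G) (I : Set G) : Set G :=
  {g | g ∈ I ∧ g - p ∉ I}

/-- The set `𝒥̃` of subsets `J` with `g ≱ h + p` for all `g, h ∈ J` (where `p = ∑ x i`). -/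
def tilJSet {G : Type*} [AddCommGroup G] {n : ℕ} (x : Fin n → G) : Set (Set G) :=
  {J | ∀ g ∈ J, ∀ h ∈ J, g - (h + ∑ i, x i) ∉ cone x}

/-- The homomorphism `ℤ^(d+1) → G` sending `e_i` to `x i`. -/
def PhiG {G : Type*} [AddCommGroup G] (d : ℕ) (x : Fin (d + 1) → G) : V d →+ G :=
  AddMonoidHom.mk' (fun v => ∑ i, v i • x i) (fun a b => by
    rw [← Finset.sum_add_distrib]
    exact Finset.sum_congr rfl fun i _ => by simp [add_smul])

/-- A finitely generated abelian group of rank one with elements `x_0, …, x_d`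
satisfying (G1), (G2), (G3).  (Rank one is expressed by the existence of a surjective
homomorphism to `ℤ` whose kernel is exactly the torsion.) -/
def GoodPair (d : ℕ) (G : Type*) [AddCommGroup G] (x : Fin (d + 1) → G) : Prop :=
  AddGroup.FG G ∧
  (∃ π' : G →+ ℤ, Function.Surjective π' ∧ ∀ g : G, π' g = 0 ↔ IsOfFinAddOrder g) ∧
  (∀ i, x i ≠ 0) ∧
  (∀ g : G, ∃ c : Fin (d + 1) → ℤ, g = ∑ i, c i • x i) ∧
  (∀ g : G, g ∈ cone x → -g ∈ cone x → g = 0)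

/-- A pair `(B, γ)` of a finite-index subgroup `B ⊆ L` and a positive integer vector `γ`
satisfying the two conditions of Theorem `chartype`. -/
def GoodBgamma (d : ℕ) (B : AddSubgroup (L d)) (γ : Fin (d + 1) → ℤ) : Prop :=
  B.FiniteIndex ∧ (∀ i, 0 < γ i) ∧ (∑ i, γ i) = (B.index : ℤ) ∧
    ∀ m' : Fin (d + 1) → ℤ, (∑ i, m' i • alpha d i) ∈ B →
      (B.index : ℤ) ∣ ∑ i, m' i * γ i

theorem alpha_coe (d : ℕ) (i : Fin (d + 1)) :
    ((alpha d i : L d) : V d) = Pi.single i 1 - Pi.single (i - 1) 1 := rfl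

theorem sum_alpha (d : ℕ) : ∑ i, alpha d i = 0 := by
  apply Subtype.ext
  rw [AddSubgroup.val_finsetSum]
  simp only [alpha_coe, Finset.sum_sub_distrib]
  have := Equiv.sum_comp (Equiv.subRight (1 : Fin (d + 1)))
    (fun i => (Pi.single i 1 : V d))
  simp only [Equiv.subRight_apply] at this
  rw [this]; simp

theorem alpha_span (d : ℕ) (x : L d) : ∃ c : V d, ∑ i, c i • alpha d i = x := by
  have hH : x ∈ AddSubgroup.closure (Set.range (alpha d)) := by
    have key : ∀ i : Fin (d + 1), ∃ y ∈ AddSubgroup.closure (Set.range (alpha d)),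
        (y : V d) = Pi.single i 1 - Pi.single 0 1 := by
      intro i
      induction i using Fin.induction with
      | zero => exact ⟨0, zero_mem _, by simp⟩
      | succ i ih =>
        obtain ⟨y, hy, hy'⟩ := ih
        refine ⟨y + alpha d i.succ,
          add_mem hy (AddSubgroup.subset_closure ⟨_, rfl⟩), ?_⟩
        have h1 : i.succ - 1 = i.castSucc := by
          rw [← Fin.coeSucc_eq_succ, add_sub_cancel_right]
        rw [AddSubgroup.coe_add, hy', alpha_coe, h1]; abel
    choose y hy hy' using key
    have hx : x = ∑ i, (x : V d) i • y i := by
      apply Subtype.ext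
      rw [AddSubgroup.val_finsetSum]
      simp only [AddSubgroup.coe_zsmul, hy', smul_sub, Finset.sum_sub_distrib]
      have h0 : ∑ i, (x : V d) i = 0 := x.2
      rw [← Finset.sum_smul, h0, zero_smul, sub_zero]
      funext j
      simp [Finset.sum_apply, Pi.single_apply]
    rw [hx]
    exact sum_mem fun i _ => AddSubgroup.zsmul_mem _ (hy i) _
  induction hH using AddSubgroup.closure_induction with
  | mem x hx =>
    obtain ⟨i, rfl⟩ := hx
    exact ⟨Pi.single i 1, by simp [Pi.single_apply]⟩
  | zero => exact ⟨0, by simp⟩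
  | add a b _ _ ha hb =>
    obtain ⟨c, rfl⟩ := ha
    obtain ⟨c', rfl⟩ := hb
    exact ⟨c + c', by simp [add_smul, Finset.sum_add_distrib]⟩
  | neg a _ ha =>
    obtain ⟨c, rfl⟩ := ha
    exact ⟨-c, by simp [Finset.sum_neg_distrib]⟩

theorem Phi_fst (d : ℕ) (B : AddSubgroup (L d)) (γ : Fin (d + 1) → ℤ) (v : V d) :
    (Phi d B γ v).1 = ∑ i, v i * γ i := rfl

theorem Phi_snd (d : ℕ) (B : AddSubgroup (L d)) (γ : Fin (d + 1) → ℤ) (v : V d) :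
    (Phi d B γ v).2 = QuotientAddGroup.mk (∑ i, v i • alpha d i) := rfl

theorem xE_fst (d : ℕ) (B : AddSubgroup (L d)) (γ : Fin (d + 1) → ℤ) (i : Fin (d + 1)) :
    (xE d B γ i : ℤ × (L d ⧸ B)).1 = γ i := by
  simp [xE, Phi_fst, Pi.single_apply]

theorem xE_snd (d : ℕ) (B : AddSubgroup (L d)) (γ : Fin (d + 1) → ℤ) (i : Fin (d + 1)) :
    (xE d B γ i : ℤ × (L d ⧸ B)).2 = QuotientAddGroup.mk (alpha d i) := by
  simp [xE, Phi_snd, Pi.single_apply]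

theorem pE_coe (d : ℕ) (B : AddSubgroup (L d)) (γ : Fin (d + 1) → ℤ)
    (hsum : (∑ i, γ i) = (B.index : ℤ)) :
    (pE d B γ : ℤ × (L d ⧸ B)) = ((B.index : ℤ), 0) := by
  have h : (pE d B γ : ℤ × (L d ⧸ B)) = Phi d B γ (∑ i, Pi.single i 1) := by
    rw [pE, AddSubgroup.val_finsetSum, map_sum]; rfl
  have h1 : (∑ i, Pi.single i 1 : V d) = fun _ => 1 := by
    funext j; simp [Finset.sum_apply, Pi.single_apply]
  rw [h, h1]
  apply Prod.ext
  · simp [Phi_fst, hsum]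
  · simp [Phi_snd, sum_alpha]

theorem add_zp_coe (d : ℕ) (B : AddSubgroup (L d)) (γ : Fin (d + 1) → ℤ)
    (hsum : (∑ i, γ i) = (B.index : ℤ)) (g : GB d B γ) (n : ℤ) :
    ((g + n • pE d B γ : GB d B γ) : ℤ × (L d ⧸ B)) =
      ((g : ℤ × (L d ⧸ B)).1 + n * (B.index : ℤ), (g : ℤ × (L d ⧸ B)).2) := by
  rw [AddSubgroup.coe_add, AddSubgroup.coe_zsmul, pE_coe d B γ hsum]
  apply Prod.ext <;> simp

theorem zp_coe (d : ℕ) (B : AddSubgroup (L d)) (γ : Fin (d + 1) → ℤ)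
    (hsum : (∑ i, γ i) = (B.index : ℤ)) (n : ℤ) :
    ((n • pE d B γ : GB d B γ) : ℤ × (L d ⧸ B)) = (n * (B.index : ℤ), 0) := by
  have := add_zp_coe d B γ hsum 0 n
  simpa using this

theorem GB_lift (d : ℕ) (B : AddSubgroup (L d)) (γ : Fin (d + 1) → ℤ) (x : L d ⧸ B) :
    ∃ g : GB d B γ, (g : ℤ × (L d ⧸ B)).2 = x := by
  obtain ⟨y, rfl⟩ := QuotientAddGroup.mk_surjective x
  obtain ⟨c, rfl⟩ := alpha_span d y
  exact ⟨⟨Phi d B γ c, c, rfl⟩, rfl⟩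

theorem GB_same (d : ℕ) (B : AddSubgroup (L d)) (γ : Fin (d + 1) → ℤ)
    (hsum : (∑ i, γ i) = (B.index : ℤ))
    (hadm : ∀ m' : Fin (d + 1) → ℤ, (∑ i, m' i • alpha d i) ∈ B →
      (B.index : ℤ) ∣ ∑ i, m' i * γ i) (g h : GB d B γ)
    (hgh : (g : ℤ × (L d ⧸ B)).2 = (h : ℤ × (L d ⧸ B)).2) :
    ∃ n : ℤ, h = g + n • pE d B γ := by
  obtain ⟨v, hv⟩ := (h - g).2
  have h2 : (Phi d B γ v).2 = 0 := by
    rw [hv, AddSubgroup.coe_sub, Prod.snd_sub, hgh, sub_self]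
  rw [Phi_snd, QuotientAddGroup.eq_zero_iff] at h2
  obtain ⟨n, hn⟩ := hadm v h2
  rw [← Phi_fst d B γ, hv, AddSubgroup.coe_sub, Prod.fst_sub] at hn
  refine ⟨n, Subtype.ext ?_⟩
  rw [add_zp_coe d B γ hsum]
  apply Prod.ext
  · show (h : ℤ × (L d ⧸ B)).1 = (g : ℤ × (L d ⧸ B)).1 + n * (B.index : ℤ)
    linarith
  · exact hgh.symm

theorem InJ_unique (d : ℕ) (B : AddSubgroup (L d)) (γ : Fin (d + 1) → ℤ)
    (hsum : (∑ i, γ i) = (B.index : ℤ))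
    (hadm : ∀ m' : Fin (d + 1) → ℤ, (∑ i, m' i • alpha d i) ∈ B →
      (B.index : ℤ) ∣ ∑ i, m' i * γ i) (J : Set (GB d B γ)) (hJ : InJ d B γ J)
    (g h : GB d B γ) (hg : g ∈ J) (hh : h ∈ J)
    (hgh : (g : ℤ × (L d ⧸ B)).2 = (h : ℤ × (L d ⧸ B)).2) : g = h := by
  obtain ⟨n, rfl⟩ := GB_same d B γ hsum hadm g h hgh
  have : n = 0 := (hJ.1 g).unique hh (by simpa using hg)
  simp [this]

theorem part_one (d : ℕ) (B : AddSubgroup (L d)) (γ : Fin (d + 1) → ℤ)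
    (hsum : (∑ i, γ i) = (B.index : ℤ))
    (hadm : ∀ m' : Fin (d + 1) → ℤ, (∑ i, m' i • alpha d i) ∈ B →
      (B.index : ℤ) ∣ ∑ i, m' i * γ i) (J : Set (GB d B γ)) (hJ : InJ d B γ J) :
    ∃ f : L d ⧸ B → ℤ, IsFJ d B γ J f ∧ IsCutDetector d B f γ := by
  have hex : ∀ x : L d ⧸ B, ∃ g : GB d B γ, g ∈ J ∧ (g : ℤ × (L d ⧸ B)).2 = x := by
    intro x
    obtain ⟨g, hg⟩ := GB_lift d B γ x
    obtain ⟨n, hn, -⟩ := hJ.1 g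
    exact ⟨_, hn, by rw [add_zp_coe d B γ hsum]; exact hg⟩
  choose s hs hs2 using hex
  obtain ⟨n0, hn0, hu⟩ := hJ.1 0
  simp only [zero_add] at hn0 hu
  have hF : ∀ g ∈ J, (s (g : ℤ × (L d ⧸ B)).2 : ℤ × (L d ⧸ B)).1 =
      (g : ℤ × (L d ⧸ B)).1 := by
    intro g hg
    rw [InJ_unique d B γ hsum hadm J hJ _ g (hs _) hg (hs2 _)]
  refine ⟨fun x => (s x : ℤ × (L d ⧸ B)).1 - n0 * (B.index : ℤ), ?_, ?_, ?_⟩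
  · intro n hn g hg
    rw [hu n hn]
    simp only [hF g hg]
  · have := hF _ hn0
    rw [zp_coe d B γ hsum] at this
    simp only at this ⊢
    rw [this, sub_self]
  · intro x i
    have hsx := hs2 (QuotientAddGroup.mk x)
    rcases hJ.2 _ (hs (QuotientAddGroup.mk x)) i with h | h
    · left
      have := hF _ h
      rw [AddSubgroup.coe_add, Prod.snd_add, hsx, xE_snd, Prod.fst_add, xE_fst,
        ← QuotientAddGroup.mk_add] at this
      simp only [this]; ring
    · right
      have := hF _ h
      rw [AddSubgroup.coe_sub, AddSubgroup.coe_add, Prod.snd_sub, Prod.snd_add, hsx, xE_snd,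
        Prod.fst_sub, Prod.fst_add, xE_fst, pE_coe d B γ hsum, sub_zero,
        ← QuotientAddGroup.mk_add] at this
      simp only [this]; ring

theorem detector_dvd (d : ℕ) (B : AddSubgroup (L d)) (γ : Fin (d + 1) → ℤ)
    (f : L d ⧸ B → ℤ) (hf : IsCutDetector d B f γ) (g : GB d B γ) :
    (B.index : ℤ) ∣ f (g : ℤ × (L d ⧸ B)).2 - (g : ℤ × (L d ⧸ B)).1 := by
  obtain ⟨g, v, rfl⟩ := g
  have key : ∀ w : V d, w ∈ AddSubgroup.closure
      (Set.range fun i : Fin (d + 1) => (Pi.single i 1 : V d)) →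
      ∀ u : L d ⧸ B, (B.index : ℤ) ∣ f (u + (Phi d B γ w).2) - f u - (Phi d B γ w).1 := by
    intro w hw
    induction hw using AddSubgroup.closure_induction with
    | mem w hw =>
      obtain ⟨i, rfl⟩ := hw
      intro u
      obtain ⟨y, rfl⟩ := QuotientAddGroup.mk_surjective u
      have h1 : (Phi d B γ (Pi.single i 1)).1 = γ i := xE_fst d B γ i
      have h2 : (Phi d B γ (Pi.single i 1)).2 = QuotientAddGroup.mk (alpha d i) :=
        xE_snd d B γ i
      simp only [h1, h2, ← QuotientAddGroup.mk_add]
      rcases hf.2 y i with h | h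
      · exact ⟨0, by rw [h]; ring⟩
      · exact ⟨-1, by rw [h]; ring⟩
    | zero => intro u; simp
    | add a b _ _ ha hb =>
      intro u
      obtain ⟨c, hc⟩ := ha u
      obtain ⟨c', hc'⟩ := hb (u + (Phi d B γ a).2)
      rw [map_add, Prod.snd_add, Prod.fst_add, ← add_assoc]
      exact ⟨c + c', by linear_combination hc + hc'⟩
    | neg a _ ha =>
      intro u
      obtain ⟨c, h⟩ := ha (u - (Phi d B γ a).2)
      rw [sub_add_cancel] at h
      rw [map_neg, Prod.snd_neg, Prod.fst_neg, ← sub_eq_add_neg]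
      exact ⟨-c, by linear_combination -h⟩
  have hv : v ∈ AddSubgroup.closure
      (Set.range fun i : Fin (d + 1) => (Pi.single i 1 : V d)) := by
    have : v = ∑ i, v i • (Pi.single i 1 : V d) := by
      funext j; simp [Finset.sum_apply, Pi.single_apply]
    rw [this]
    exact sum_mem fun i _ => AddSubgroup.zsmul_mem _ (AddSubgroup.subset_closure (Set.mem_range_self i)) _
  have := key v hv 0
  rw [hf.1] at this
  simpa using this

theorem part_two (d : ℕ) (B : AddSubgroup (L d)) (γ : Fin (d + 1) → ℤ)
    (hm : (B.index : ℤ) ≠ 0) (hsum : (∑ i, γ i) = (B.index : ℤ))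
    (f : L d ⧸ B → ℤ) (hf : IsCutDetector d B f γ) :
    ∃ J : Set (GB d B γ), InJ d B γ J ∧ IsFJ d B γ J f := by
  refine ⟨{g | f (g : ℤ × (L d ⧸ B)).2 = (g : ℤ × (L d ⧸ B)).1}, ⟨?_, ?_⟩, ?_⟩
  · intro g
    obtain ⟨n, hn⟩ := detector_dvd d B γ f hf g
    refine ⟨n, ?_, ?_⟩
    · simp only [Set.mem_ofPred_eq, add_zp_coe d B γ hsum]
      linarith
    · intro k hk
      simp only [Set.mem_ofPred_eq, add_zp_coe d B γ hsum] at hk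
      apply mul_right_cancel₀ hm
      linarith
  · intro g hg i
    simp only [Set.mem_ofPred_eq] at hg ⊢
    obtain ⟨y, hy⟩ := QuotientAddGroup.mk_surjective (g : ℤ × (L d ⧸ B)).2
    rw [AddSubgroup.coe_sub, AddSubgroup.coe_add, Prod.snd_sub, Prod.snd_add, xE_snd,
        Prod.fst_sub, Prod.fst_add, xE_fst, pE_coe d B γ hsum, sub_zero, ← hy,
        ← QuotientAddGroup.mk_add, ← hg, ← hy]
    exact hf.2 y i
  · intro n hn g hg
    simp only [Set.mem_ofPred_eq, zp_coe d B γ hsum] at hn hg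
    rw [← hn, hf.1, hg, sub_zero]

theorem mem_iff (d : ℕ) (B : AddSubgroup (L d)) (γ : Fin (d + 1) → ℤ)
    (hm : (B.index : ℤ) ≠ 0) (hsum : (∑ i, γ i) = (B.index : ℤ))
    (J : Set (GB d B γ)) (hJ : InJ d B γ J) (f : L d ⧸ B → ℤ) (hf : IsFJ d B γ J f) :
    ∃ n : ℤ, ∀ g : GB d B γ, g ∈ J ↔
      (g : ℤ × (L d ⧸ B)).1 = f (g : ℤ × (L d ⧸ B)).2 + n * (B.index : ℤ) := by
  obtain ⟨n, hn, -⟩ := hJ.1 0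
  rw [zero_add] at hn
  refine ⟨n, fun g => ⟨fun hg => by rw [hf n hn g hg]; ring, fun hg => ?_⟩⟩
  obtain ⟨k, hk, -⟩ := hJ.1 g
  have h := hf n hn _ hk
  rw [add_zp_coe d B γ hsum] at h
  simp only at h
  have hk0 : k = 0 := by
    apply mul_right_cancel₀ hm
    linarith
  simpa [hk0] using hk

theorem fJ_detector_surjective_fibers (d : ℕ) (hd : 1 ≤ d) (B : AddSubgroup (L d))
    [B.FiniteIndex] (γ : Fin (d + 1) → ℤ) (hγ : ∀ i, 0 ≤ γ i)
    (hsum : (∑ i, γ i) = (B.index : ℤ))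
    (hadm : ∀ m' : Fin (d + 1) → ℤ, (∑ i, m' i • alpha d i) ∈ B →
      (B.index : ℤ) ∣ ∑ i, m' i * γ i) :
    (∀ J : Set (GB d B γ), InJ d B γ J →
      ∃ f : L d ⧸ B → ℤ, IsFJ d B γ J f ∧ IsCutDetector d B f γ) ∧
    (∀ f : L d ⧸ B → ℤ, IsCutDetector d B f γ →
      ∃ J : Set (GB d B γ), InJ d B γ J ∧ IsFJ d B γ J f) ∧
    (∀ J J' : Set (GB d B γ), InJ d B γ J → InJ d B γ J' →
      ((∃ f : L d ⧸ B → ℤ, IsFJ d B γ J f ∧ IsFJ d B γ J' f) ↔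
        ∃ n : ℤ, J' = (fun g => g + n • pE d B γ) '' J)) := by
  have hm : (B.index : ℤ) ≠ 0 := by exact_mod_cast AddSubgroup.FiniteIndex.index_ne_zero
  refine ⟨part_one d B γ hsum hadm, part_two d B γ hm hsum, ?_⟩
  intro J J' hJ hJ'
  constructor
  · rintro ⟨f, hf, hf'⟩
    obtain ⟨n, hn⟩ := mem_iff d B γ hm hsum J hJ f hf
    obtain ⟨n', hn'⟩ := mem_iff d B γ hm hsum J' hJ' f hf'
    refine ⟨n' - n, ?_⟩
    ext1 g
    rw [hn']
    constructor
    · intro h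
      refine ⟨g + (n - n') • pE d B γ, ?_, ?_⟩
      · rw [hn, add_zp_coe d B γ hsum]
        simp only [h]; ring
      · simp only [sub_smul]
        abel
    · rintro ⟨g, hg, rfl⟩
      rw [hn] at hg
      simp only [add_zp_coe d B γ hsum, hg]; ring
  · rintro ⟨n, rfl⟩
    obtain ⟨f, hf, -⟩ := part_one d B γ hsum hadm J hJ
    refine ⟨f, hf, ?_⟩
    rintro k ⟨h, hh, hk⟩ _ ⟨g, hg, rfl⟩
    have h1 : h = (k - n) • pE d B γ := by
      rw [sub_smul, ← hk]; simp
    rw [h1] at hh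
    have := hf _ hh g hg
    simp only [add_zp_coe d B γ hsum, this]; ring

end Paper
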